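/- Let g = sl(3,ℂ). If a bilinear alternating map f : g × g → g and an alternating bilinear form σ : g × g → ℂ satisfy [f(x,y),z] + [f(y,z),x] + [f(z,x),y] + σ(x,y)·z + σ(y,z)·x + σ(z,x)·y = 0 for all x,y,z ∈ g, then σ = 0 and f is a scalar multiple of the Lie bracket. -/

import Mathlib

set_option linter.unusedSimpArgs false
set_option linter.unusedVariables false

/-- Kronecker delta. -/
noncomputable def d (a b : Fin 3) : ℂ := if a = b then 1 else 0

/-- One cyclic term of the identity in coordinates. -/
noncomputable def T (F : Fin 3 → Fin 3 → Fin 3 → Fin 3 → Fin 3 → Fin 3 → ℂ)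
    (G : Fin 3 → Fin 3 → Fin 3 → Fin 3 → ℂ) (i j k l p q m n : Fin 3) : ℂ :=
  F i j k l m p * d q n - d m p * F i j k l q n
    + G i j k l * (d m p * d q n - d p q * d m n / 3)

/-- The linear system satisfied by the coordinates. -/
structure Sys (F : Fin 3 → Fin 3 → Fin 3 → Fin 3 → Fin 3 → Fin 3 → ℂ)
    (G : Fin 3 → Fin 3 → Fin 3 → Fin 3 → ℂ) : Prop where
  aF : ∀ i j k l m n, F i j k l m n = - F k l i j m n
  aG : ∀ i j k l, G i j k l = - G k l i j
  t1 : ∀ k l m n, ∑ i, F i i k l m n = 0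
  t3 : ∀ i j k l, ∑ m, F i j k l m m = 0
  s1 : ∀ k l, ∑ i, G i i k l = 0
  B : ∀ i j k l p q m n, T F G i j k l p q m n + T F G k l p q i j m n
    + T F G p q i j k l m n = 0

namespace Sys
variable {F : Fin 3 → Fin 3 → Fin 3 → Fin 3 → Fin 3 → Fin 3 → ℂ}
    {G : Fin 3 → Fin 3 → Fin 3 → Fin 3 → ℂ}

theorem tA (h : Sys F G) (k l m n) : F 2 2 k l m n = - F 0 0 k l m n - F 1 1 k l m n := by
  have := h.t1 k l m n
  rw [Fin.sum_univ_three] at this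
  linear_combination this

theorem tB (h : Sys F G) (k l m n) : F k l 2 2 m n = - F k l 0 0 m n - F k l 1 1 m n := by
  have := h.t1 k l m n
  rw [Fin.sum_univ_three] at this
  rw [h.aF k l 2 2, h.aF k l 0 0, h.aF k l 1 1]
  linear_combination - this

theorem tC (h : Sys F G) (i j k l) : F i j k l 2 2 = - F i j k l 0 0 - F i j k l 1 1 := by
  have := h.t3 i j k l
  rw [Fin.sum_univ_three] at this
  linear_combination this

theorem tA' (h : Sys F G) (k l) : G 2 2 k l = - G 0 0 k l - G 1 1 k l := by
  have := h.s1 k l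
  rw [Fin.sum_univ_three] at this
  linear_combination this

theorem tB' (h : Sys F G) (k l) : G k l 2 2 = - G k l 0 0 - G k l 1 1 := by
  have := h.s1 k l
  rw [Fin.sum_univ_three] at this
  rw [h.aG k l 2 2, h.aG k l 0 0, h.aG k l 1 1]
  linear_combination - this

theorem aF' (h : Sys F G) (i j k l m n) (_ : k < i ∨ (k = i ∧ l < j)) :
    F i j k l m n = - F k l i j m n := h.aF i j k l m n

theorem aG' (h : Sys F G) (i j k l) (_ : k < i ∨ (k = i ∧ l < j)) :
    G i j k l = - G k l i j := h.aG i j k l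

theorem sF (h : Sys F G) (i j m n) : F i j i j m n = 0 := by
  have := h.aF i j i j m n
  linear_combination this / 2

theorem sG (h : Sys F G) (i j) : G i j i j = 0 := by
  have := h.aG i j i j
  linear_combination this / 2

theorem perm (h : Sys F G) (π : Equiv.Perm (Fin 3)) :
    Sys (fun i j k l m n => F (π i) (π j) (π k) (π l) (π m) (π n))
      (fun i j k l => G (π i) (π j) (π k) (π l)) where
  aF i j k l m n := h.aF _ _ _ _ _ _
  aG i j k l := h.aG _ _ _ _
  t1 k l m n := by
    rw [Equiv.sum_comp π (fun i => F i i (π k) (π l) (π m) (π n))]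
    exact h.t1 _ _ _ _
  t3 i j k l := by
    rw [Equiv.sum_comp π (fun m => F (π i) (π j) (π k) (π l) m m)]
    exact h.t3 _ _ _ _
  s1 k l := by
    rw [Equiv.sum_comp π (fun i => G i i (π k) (π l))]
    exact h.s1 _ _
  B i j k l p q m n := by
    have := h.B (π i) (π j) (π k) (π l) (π p) (π q) (π m) (π n)
    simpa [T, d] using this

end Sys

theorem cls0 {F G} (h : Sys F G) :
    F 1 0 2 0 0 2 = 0 := by
  have e0 := h.B 0 0 1 0 2 0 0 2
  simp [T, d, h.tA, h.tB, h.tC, h.aF', h.sF, h.tA', h.tB', h.aG', h.sG] at e0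
  grind

theorem cls1 {F G} (h : Sys F G) :
    F 0 1 0 2 2 0 = 0 := by
  have e0 := h.B 0 0 0 1 0 2 2 0
  simp [T, d, h.tA, h.tB, h.tC, h.aF', h.sF, h.tA', h.tB', h.aG', h.sG] at e0
  grind

theorem cls2 {F G} (h : Sys F G) :
    F 0 0 2 0 0 2 = 0 ∧
    F 1 0 2 0 1 2 = 0 ∧
    F 1 0 2 1 0 2 = 0 ∧
    F 1 1 2 0 0 2 = 0 ∧
    F 2 0 2 1 0 1 = 0 := by
  have e0 := h.B 0 0 1 0 2 0 1 2
  have e1 := h.B 0 0 1 0 2 1 0 2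
  have e2 := h.B 0 0 1 1 2 0 0 2
  have e3 := h.B 0 1 1 0 2 0 0 2
  have e4 := h.B 1 2 2 0 2 1 0 2
  simp [T, d, h.tA, h.tB, h.tC, h.aF', h.sF, h.tA', h.tB', h.aG', h.sG] at e0 e1 e2 e3 e4
  grind

theorem cls3 {F G} (h : Sys F G) :
    F 0 0 1 0 0 2 = 0 ∧
    F 0 0 2 0 0 1 = 0 ∧
    F 1 0 1 1 0 2 = 0 ∧
    F 1 0 2 0 0 0 = 0 ∧
    F 1 0 2 0 1 1 = 0 ∧
    F 1 0 2 1 0 1 = 0 ∧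
    F 1 1 2 0 0 1 = 0 ∧
    F 1 2 2 0 0 2 = 0 := by
  have e0 := h.B 0 0 1 0 1 1 0 2
  have e1 := h.B 1 0 1 2 2 1 0 2
  have e2 := h.B 1 1 1 2 2 0 0 2
  have e3 := h.B 1 2 2 0 2 1 0 1
  have e4 := h.B 0 0 1 0 2 0 1 1
  have e5 := h.B 0 0 1 0 2 1 0 1
  have e6 := h.B 0 0 1 1 2 0 0 1
  have e7 := h.B 0 1 1 0 2 0 0 1
  have e8 := h.B 0 2 1 0 2 0 0 2
  simp [T, d, h.tA, h.tB, h.tC, h.aF', h.sF, h.tA', h.tB', h.aG', h.sG] at e0 e1 e2 e3 e4 e5 e6 e7 e8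
  grind

theorem cls4 {F G} (h : Sys F G) :
    F 0 0 0 1 2 0 = 0 ∧
    F 0 0 0 2 1 0 = 0 ∧
    F 0 1 0 2 0 0 = 0 ∧
    F 0 1 0 2 1 1 = 0 ∧
    F 0 1 1 1 2 0 = 0 ∧
    F 0 1 1 2 1 0 = 0 ∧
    F 0 2 1 1 1 0 = 0 ∧
    F 0 2 2 1 2 0 = 0 := by
  have e0 := h.B 0 0 0 1 1 1 2 0
  have e1 := h.B 0 1 1 2 2 1 2 0
  have e2 := h.B 0 2 1 1 2 1 2 0
  have e3 := h.B 0 2 1 2 2 1 1 0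
  have e4 := h.B 0 0 0 1 0 2 1 1
  have e5 := h.B 0 0 0 1 1 2 1 0
  have e6 := h.B 0 0 0 2 1 1 1 0
  have e7 := h.B 0 1 0 2 1 0 1 0
  have e8 := h.B 0 1 0 2 2 0 2 0
  simp [T, d, h.tA, h.tB, h.tC, h.aF', h.sF, h.tA', h.tB', h.aG', h.sG] at e0 e1 e2 e3 e4 e5 e6 e7 e8
  grind

theorem cls5 {F G} (h : Sys F G) :
    F 0 0 1 0 1 2 = 0 ∧
    F 0 0 1 1 0 2 = 0 ∧
    F 0 0 2 0 0 0 = 0 ∧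
    F 0 0 2 0 1 1 = 0 ∧
    F 0 0 2 1 0 1 = 0 ∧
    F 0 1 1 0 0 2 = 0 ∧
    F 0 1 2 0 0 1 = 0 ∧
    F 0 2 2 0 0 2 = 0 ∧
    F 1 0 1 1 1 2 = 0 ∧
    F 1 0 2 0 1 0 = 0 ∧
    F 1 0 2 1 0 0 = 0 ∧
    F 1 0 2 1 1 1 = 0 ∧
    F 1 1 2 0 0 0 = 0 ∧
    F 1 1 2 0 1 1 = 0 ∧
    F 1 1 2 1 0 1 = 0 ∧
    F 1 2 2 0 1 2 = 0 ∧
    F 1 2 2 1 0 2 = 0 ∧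
    F 2 0 2 1 2 1 = 0 := by
  have e0 := h.B 0 1 1 0 1 1 0 2
  have e1 := h.B 1 1 1 2 2 1 0 2
  have e2 := h.B 1 2 2 0 2 1 0 0
  have e3 := h.B 0 0 0 1 1 0 0 2
  have e4 := h.B 0 0 1 0 1 1 1 2
  have e5 := h.B 0 0 1 0 2 1 0 0
  have e6 := h.B 0 0 1 1 2 0 1 1
  have e7 := h.B 0 0 1 2 2 1 0 2
  have e8 := h.B 0 1 1 0 2 0 1 1
  have e9 := h.B 0 1 1 2 2 0 0 2
  have e10 := h.B 0 2 1 0 2 0 1 2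
  have e11 := h.B 0 2 2 0 2 1 0 1
  have e12 := h.B 1 2 2 0 2 1 1 1
  have e13 := h.B 0 0 1 0 2 1 1 1
  have e14 := h.B 0 0 1 1 2 0 0 0
  have e15 := h.B 0 0 1 2 2 0 1 2
  have e16 := h.B 0 2 1 0 2 1 0 2
  have e17 := h.B 0 2 1 1 2 0 0 2
  have e18 := h.B 0 0 0 1 2 0 0 1
  have e19 := h.B 0 1 1 0 2 1 0 1
  have e20 := h.B 0 1 1 1 2 0 0 1
  simp [T, d, h.tA, h.tB, h.tC, h.aF', h.sF, h.tA', h.tB', h.aG', h.sG] at e0 e1 e2 e3 e4 e5 e6 e7 e8 e9 e10 e11 e12 e13 e14 e15 e16 e17 e18 e19 e20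
  grind

theorem cls6 {F G} (h : Sys F G) (h0 : F 0 1 1 2 0 2 = 0) :
    F 0 0 0 1 0 1 = 0 ∧
    F 0 0 0 2 0 2 = 0 ∧
    F 0 0 1 0 1 0 = 0 ∧
    F 0 0 1 1 0 0 = 0 ∧
    F 0 0 1 1 1 1 = 0 ∧
    F 0 0 1 2 1 2 = 0 ∧
    F 0 0 2 0 2 0 = 0 ∧
    F 0 0 2 1 2 1 = 0 ∧
    F 0 1 1 0 0 0 = 0 ∧
    F 0 1 1 0 1 1 = 0 ∧
    F 0 1 1 1 0 1 = 0 ∧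
    F 0 1 1 2 0 2 = 0 ∧
    F 0 1 2 0 2 1 = 0 ∧
    F 0 2 1 0 1 2 = 0 ∧
    F 0 2 1 1 0 2 = 0 ∧
    F 0 2 2 0 0 0 = 0 ∧
    F 0 2 2 0 1 1 = 0 ∧
    F 0 2 2 1 0 1 = 0 ∧
    F 1 0 1 1 1 0 = 0 ∧
    F 1 0 2 1 2 0 = 0 ∧
    F 1 1 1 2 1 2 = 0 ∧
    F 1 1 2 0 2 0 = 0 ∧
    F 1 1 2 1 2 1 = 0 ∧
    F 1 2 2 0 1 0 = 0 ∧
    F 1 2 2 1 0 0 = 0 ∧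
    F 1 2 2 1 1 1 = 0 := by
  have e0 := h.B 0 0 0 2 2 0 1 1
  have e1 := h.B 0 0 1 2 2 1 0 0
  have e2 := h.B 0 0 0 1 2 0 2 1
  have e3 := h.B 0 0 0 2 1 0 1 2
  have e4 := h.B 0 1 1 1 1 2 0 2
  have e5 := h.B 0 1 1 2 2 0 0 0
  have e6 := h.B 0 1 1 2 2 0 1 1
  have e7 := h.B 0 2 1 0 2 1 0 0
  have e8 := h.B 0 2 1 0 2 1 1 1
  have e9 := h.B 1 0 1 1 2 1 2 0
  have e10 := h.B 0 0 0 1 1 0 0 0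
  have e11 := h.B 0 0 0 1 1 0 1 1
  have e12 := h.B 0 0 0 1 1 2 0 2
  have e13 := h.B 0 0 0 2 2 1 0 1
  have e14 := h.B 0 0 1 0 2 1 2 0
  have e15 := h.B 0 0 1 2 2 0 1 0
  have e16 := h.B 0 1 1 0 1 1 0 0
  have e17 := h.B 0 1 1 1 2 0 2 1
  have e18 := h.B 0 2 1 0 1 1 1 2
  have e19 := h.B 0 2 1 1 2 1 0 1
  have e20 := h.B 0 0 0 2 1 1 0 2
  have e21 := h.B 0 0 1 1 1 2 1 2
  have e22 := h.B 0 0 1 1 2 0 2 0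
  have e23 := h.B 0 1 0 2 1 0 0 2
  have e24 := h.B 0 1 0 2 2 0 0 1
  have e25 := h.B 0 1 1 0 1 2 1 2
  have e26 := h.B 0 1 1 2 2 1 0 1
  have e27 := h.B 0 2 1 2 2 0 1 2
  have e28 := h.B 0 2 1 2 2 1 0 2
  simp [T, d, h.tA, h.tB, h.tC, h.aF', h.sF, h.tA', h.tB', h.aG', h.sG] at e0 e1 e2 e3 e4 e5 e6 e7 e8 e9 e10 e11 e12 e13 e14 e15 e16 e17 e18 e19 e20 e21 e22 e23 e24 e25 e26 e27 e28
  grind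

/-- Torus weight of a coordinate. -/
def wt (i j k l m n a : Fin 3) : ℤ :=
  (if i = a then 1 else 0) + (if k = a then 1 else 0) + (if n = a then 1 else 0)
    - (if j = a then 1 else 0) - (if l = a then 1 else 0) - (if m = a then 1 else 0)

/-- Representatives of weights modulo permutations. -/
def rep (i j k l m n : Fin 3) : Bool :=
  [((-3 : ℤ), (1 : ℤ)), (3, -1), (-2, 0), (-2, 1), (2, -1), (-1, 0), (3, -3)].contains
    (wt i j k l m n 0, wt i j k l m n 1)

/-- Zero weight. -/
def zer (i j k l m n : Fin 3) : Bool :=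
  (wt i j k l m n 0, wt i j k l m n 1) == ((0 : ℤ), (0 : ℤ))

theorem all_rep {F G} (h : Sys F G) (i j k l m n : Fin 3) (hr : rep i j k l m n = true) :
    F i j k l m n = 0 := by
  have c0 := cls0 h
  have c1 := cls1 h
  have c2 := cls2 h
  have c3 := cls3 h
  have c4 := cls4 h
  have c5 := cls5 h
  fin_cases i <;> fin_cases j <;> fin_cases k <;> fin_cases l <;> fin_cases m <;> fin_cases n <;>
    first
    | exact absurd hr (by decide)
    | simp [c0, c1, c2, c3, c4, c5, h.tA, h.tB, h.tC, h.aF', h.sF]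

theorem all_zer {F G} (h : Sys F G) (h0 : F 0 1 1 2 0 2 = 0)
    (i j k l m n : Fin 3) (hr : zer i j k l m n = true) :
    F i j k l m n = 0 := by
  have c6 := cls6 h h0
  fin_cases i <;> fin_cases j <;> fin_cases k <;> fin_cases l <;> fin_cases m <;> fin_cases n <;>
    first
    | exact absurd hr (by decide)
    | simp [c6, h.tA, h.tB, h.tC, h.aF', h.sF]

/-- The six permutations. -/
def tab : Fin 6 → Fin 3 → Fin 3 :=
  ![![0, 1, 2], ![0, 2, 1], ![1, 0, 2], ![1, 2, 0], ![2, 0, 1], ![2, 1, 0]]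

theorem tab_perm (t : Fin 6) : ∃ π : Equiv.Perm (Fin 3), ∀ a, π (tab t a) = a := by
  have hb : Function.Bijective (tab t) := by
    revert t; decide
  exact ⟨(Equiv.ofBijective _ hb).symm, fun a => (Equiv.ofBijective _ hb).symm_apply_apply a⟩

theorem cover : ∀ i j k l m n : Fin 3, zer i j k l m n = true ∨
    ∃ t : Fin 6, rep (tab t i) (tab t j) (tab t k) (tab t l) (tab t m) (tab t n) = true := by
  decide +kernel

theorem all_F {F G} (h : Sys F G) (h0 : F 0 1 1 2 0 2 = 0) (i j k l m n : Fin 3) :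
    F i j k l m n = 0 := by
  rcases cover i j k l m n with hz | ⟨t, ht⟩
  · exact all_zer h h0 _ _ _ _ _ _ hz
  · obtain ⟨π, hπ⟩ := tab_perm t
    have := all_rep (h.perm π) _ _ _ _ _ _ ht
    simpa [hπ] using this

theorem all_G {F G} (h : Sys F G) (h0 : F 0 1 1 2 0 2 = 0) (i j k l : Fin 3) :
    G i j k l = 0 := by
  have key : ∀ i j k l : Fin 3, ∃ p q : Fin 3, p ≠ q ∧ ¬ (p = i ∧ j = q) ∧ ¬ (p = k ∧ l = q) := by
    decide +kernel
  obtain ⟨p, q, h1, h2, h3⟩ := key i j k l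
  have := h.B i j k l p q p q
  have e2 : d p i * d j q = 0 := by
    unfold d; split_ifs <;> simp_all
  have e3 : d p k * d l q = 0 := by
    unfold d; split_ifs <;> simp_all
  have e1 : d p q = 0 := by simp [d, h1]
  have e4 : ∀ a, d a a = 1 := by simp [d]
  simpa [T, all_F h h0, e1, e2, e3, e4] using this


open LieAlgebra.SpecialLinear in
theorem sl_trace (x : sl (Fin 3) ℂ) :
    Matrix.trace (x.1 : Matrix (Fin 3) (Fin 3) ℂ) = 0 := x.2

/-- Projected matrix units. -/
noncomputable def E (i j : Fin 3) : LieAlgebra.SpecialLinear.sl (Fin 3) ℂ :=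
  ⟨Matrix.single i j 1 - (d i j / 3) • (1 : Matrix (Fin 3) (Fin 3) ℂ), by
    change Matrix.trace (_ : Matrix (Fin 3) (Fin 3) ℂ) = 0
    by_cases h : i = j
    · subst h
      simp [d]
    · simp [d, h]⟩

open LieAlgebra.SpecialLinear in
/-- Matrix entries. -/
def ent (x : sl (Fin 3) ℂ) (m n : Fin 3) : ℂ := (x.1 : Matrix (Fin 3) (Fin 3) ℂ) m n

open LieAlgebra.SpecialLinear in
theorem ent_ext {x y : sl (Fin 3) ℂ} (h : ∀ m n, ent x m n = ent y m n) : x = y := by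
  apply Subtype.ext
  funext m n
  exact h m n

open LieAlgebra.SpecialLinear in
theorem ent_add (x y : sl (Fin 3) ℂ) (m n) : ent (x + y) m n = ent x m n + ent y m n := rfl

open LieAlgebra.SpecialLinear in
theorem ent_sub (x y : sl (Fin 3) ℂ) (m n) : ent (x - y) m n = ent x m n - ent y m n := rfl

open LieAlgebra.SpecialLinear in
theorem ent_neg (x : sl (Fin 3) ℂ) (m n) : ent (-x) m n = - ent x m n := rfl

open LieAlgebra.SpecialLinear in
theorem ent_smul (c : ℂ) (x : sl (Fin 3) ℂ) (m n) : ent (c • x) m n = c * ent x m n := rfl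

theorem ent_zero (m n) : ent 0 m n = 0 := rfl

open LieAlgebra.SpecialLinear in
theorem ent_lie (x y : sl (Fin 3) ℂ) (m n) :
    ent ⁅x, y⁆ m n = ∑ k, ent x m k * ent y k n - ∑ k, ent y m k * ent x k n := by
  change (⁅x, y⁆ : sl (Fin 3) ℂ).1 m n = _
  rw [sl_bracket]
  rfl

theorem E_apply (i j m n : Fin 3) : ent (E i j) m n = d m i * d j n - d i j * d m n / 3 := by
  change (Matrix.single i j (1 : ℂ) - (d i j / 3) • (1 : Matrix (Fin 3) (Fin 3) ℂ) :
    Matrix (Fin 3) (Fin 3) ℂ) m n = _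
  simp only [d, Matrix.sub_apply, Matrix.single_apply, Matrix.smul_apply, Matrix.one_apply,
    smul_eq_mul]
  fin_cases i <;> fin_cases j <;> fin_cases m <;> fin_cases n <;> simp

theorem E_sum : ∑ i, E i i = 0 := by
  apply ent_ext
  intro m n
  rw [Fin.sum_univ_three]
  simp only [ent_add, E_apply, ent_zero]
  fin_cases m <;> fin_cases n <;> simp [d] <;> norm_num

open LieAlgebra.SpecialLinear in
theorem lie_E (a : sl (Fin 3) ℂ) (p q m n : Fin 3) :
    ent ⁅a, E p q⁆ m n = ent a m p * d q n - d m p * ent a q n := by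
  rw [ent_lie]
  simp only [E_apply, Fin.sum_univ_three]
  fin_cases p <;> fin_cases q <;> fin_cases m <;> fin_cases n <;> simp [d] <;> ring

open LieAlgebra.SpecialLinear in
theorem expand (x : sl (Fin 3) ℂ) : x = ∑ i, ∑ j, ent x i j • E i j := by
  apply ent_ext
  have ht := sl_trace x
  rw [Matrix.trace_fin_three] at ht
  change ent x 0 0 + ent x 1 1 + ent x 2 2 = 0 at ht
  intro m n
  simp only [Fin.sum_univ_three, ent_add, ent_smul, E_apply]
  fin_cases m <;> fin_cases n <;> simp [d] <;> first | linear_combination ht / 3 | ring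

open LieAlgebra.SpecialLinear in
theorem core
    (f : sl (Fin 3) ℂ →ₗ[ℂ] sl (Fin 3) ℂ →ₗ[ℂ] sl (Fin 3) ℂ)
    (σ : sl (Fin 3) ℂ →ₗ[ℂ] sl (Fin 3) ℂ →ₗ[ℂ] ℂ)
    (hf : ∀ x, f x x = 0) (hσ : ∀ x, σ x x = 0)
    (H : ∀ x y z : sl (Fin 3) ℂ,
      ⁅f x y, z⁆ + ⁅f y z, x⁆ + ⁅f z x, y⁆
        + σ x y • z + σ y z • x + σ z x • y = 0)
    (h0 : ent (f (E 0 1) (E 1 2)) 0 2 = 0) : σ = 0 ∧ f = 0 := by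
  have af : ∀ x y, f x y = - f y x := fun x y => by
    have := hf (x + y)
    simp only [map_add, LinearMap.add_apply, hf, zero_add, add_zero] at this
    exact eq_neg_of_add_eq_zero_right this
  have aσ : ∀ x y, σ x y = - σ y x := fun x y => by
    have := hσ (x + y)
    simp only [map_add, LinearMap.add_apply, hσ, zero_add, add_zero] at this
    exact eq_neg_of_add_eq_zero_right this
  have S : Sys (fun i j k l m n => ent (f (E i j) (E k l)) m n)
      (fun i j k l => σ (E i j) (E k l)) :=
    { aF := fun i j k l m n => by
        rw [af]; rfl
      aG := fun i j k l => aσ _ _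
      t1 := fun k l m n => by
        have : ent (f (∑ i, E i i) (E k l)) m n = 0 := by
          rw [E_sum]; simp [ent_zero]
        rw [Fin.sum_univ_three] at this ⊢
        simpa [ent_add] using this
      t3 := fun i j k l => sl_trace (f (E i j) (E k l))
      s1 := fun k l => by
        have : σ (∑ i, E i i) (E k l) = 0 := by rw [E_sum]; simp
        rw [Fin.sum_univ_three] at this ⊢
        simpa using this
      B := fun i j k l p q m n => by
        have := congrArg (fun w : sl (Fin 3) ℂ => ent w m n) (H (E i j) (E k l) (E p q))
        simp only [ent_add, ent_smul, lie_E, E_apply, ent_zero] at this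
        simp only [T]
        linear_combination this }
  have hF : ∀ i j k l, f (E i j) (E k l) = 0 := fun i j k l => by
    apply ent_ext
    intro m n
    exact all_F S h0 i j k l m n
  have hG : ∀ i j k l, σ (E i j) (E k l) = 0 := fun i j k l => all_G S h0 i j k l
  constructor
  · ext x y
    rw [expand x, expand y]
    simp [map_sum, LinearMap.sum_apply, hG]
  · apply LinearMap.ext₂
    intro x y
    rw [expand x, expand y]
    simp [map_sum, LinearMap.sum_apply, hF]

/-- Theorem (Bianchi identity for `sl(3,ℂ)`): if an alternating bilinear map
`f : ∧²g → g` and an alternating bilinear form `σ : ∧²g*` on `g = sl(3,ℂ)` satisfy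
`[f(x,y),z] + [f(y,z),x] + [f(z,x),y] + σ(x,y)z + σ(y,z)x + σ(z,x)y = 0`
for all `x, y, z`, then `σ = 0` and `f` is a scalar multiple of the Lie bracket. -/
theorem stmt0
    (f : LieAlgebra.SpecialLinear.sl (Fin 3) ℂ →ₗ[ℂ]
      LieAlgebra.SpecialLinear.sl (Fin 3) ℂ →ₗ[ℂ] LieAlgebra.SpecialLinear.sl (Fin 3) ℂ)
    (σ : LieAlgebra.SpecialLinear.sl (Fin 3) ℂ →ₗ[ℂ]
      LieAlgebra.SpecialLinear.sl (Fin 3) ℂ →ₗ[ℂ] ℂ)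
    (hf : ∀ x, f x x = 0) (hσ : ∀ x, σ x x = 0)
    (H : ∀ x y z : LieAlgebra.SpecialLinear.sl (Fin 3) ℂ,
      ⁅f x y, z⁆ + ⁅f y z, x⁆ + ⁅f z x, y⁆
        + σ x y • z + σ y z • x + σ z x • y = 0) :
    σ = 0 ∧ ∃ s : ℂ, ∀ x y, f x y = s • ⁅x, y⁆ := by
  set s : ℂ := ent (f (E 0 1) (E 1 2)) 0 2 with hs
  set b : LieAlgebra.SpecialLinear.sl (Fin 3) ℂ →ₗ[ℂ]
      LieAlgebra.SpecialLinear.sl (Fin 3) ℂ →ₗ[ℂ] LieAlgebra.SpecialLinear.sl (Fin 3) ℂ :=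
    LinearMap.mk₂ ℂ (fun x y => ⁅x, y⁆) (fun x y z => add_lie x y z)
      (fun c x y => smul_lie c x y) (fun x y z => lie_add x y z) (fun c x y => lie_smul c x y) with hb
  have hb' : ∀ x y, b x y = ⁅x, y⁆ := fun x y => rfl
  have key := core (f - s • b) σ (fun x => by simp [hf, hb']) hσ (fun x y z => by
      have h1 := H x y z
      have h2 : ⁅⁅x, y⁆, z⁆ + ⁅⁅y, z⁆, x⁆ + ⁅⁅z, x⁆, y⁆ = 0 := by
        have := lie_jacobi x y z
        rw [← lie_skew x ⁅y, z⁆, ← lie_skew y ⁅z, x⁆, ← lie_skew z ⁅x, y⁆] at this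
        rw [← neg_eq_zero, ← this]
        abel
      have h3 : s • (⁅⁅x, y⁆, z⁆ + ⁅⁅y, z⁆, x⁆ + ⁅⁅z, x⁆, y⁆) = 0 := by rw [h2, smul_zero]
      simp only [LinearMap.sub_apply, LinearMap.smul_apply, hb', sub_lie, smul_lie]
      rw [smul_add, smul_add] at h3
      rw [← sub_zero (0 : LieAlgebra.SpecialLinear.sl (Fin 3) ℂ)]
      nth_rewrite 1 [← h1]
      rw [← h3]
      abel) (by
      have : ent ⁅E 0 1, E 1 2⁆ 0 2 = 1 := by
        rw [lie_E]; simp [E_apply, d]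
      simp only [LinearMap.sub_apply, LinearMap.smul_apply, hb', ent_sub, ent_smul, this]
      simp [hs])
  refine ⟨key.1, s, fun x y => ?_⟩
  have := LinearMap.congr_fun₂ key.2 x y
  simpa [sub_eq_zero, hb'] using this
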